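/- arXiv:2111.14417 — 6 statements merged into one kernel-verified Lean document; each statement's English description precedes it below -/
import Mathlib

section
/- Every Condorcet-consistent social decision rule satisfies top consistency: if C is an SDR with C(R) = CW(R) for every profile R with CW(R) ≠ ∅, then for every profile R with N_C(R) ≠ ∅ one has C(R) = N_C(R). -/
/-- A weak order on `A`: a complete (total) and transitive binary relation. -/
structure WeakOrd (A : Type*) where
  rel : A → A → Prop
  total : ∀ x y, rel x y ∨ rel y x
  trans : ∀ x y z, rel x y → rel y z → rel x z

namespace WeakOrd

variable {A : Type*}

/-- Strict preference. -/
def strict (r : WeakOrd A) (x y : A) : Prop := r.rel x y ∧ ¬ r.rel y x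

/-- Indifference. -/
def indiff (r : WeakOrd A) (x y : A) : Prop := r.rel x y ∧ r.rel y x

open Classical in
/-- The weak order obtained from `r` by moving `x` and `y` strictly above all other
alternatives, preserving the relative ranking of `x` and `y` and of the rest. -/
noncomputable def topShift (r : WeakOrd A) (x y : A) : WeakOrd A where
  rel a b :=
    if a = x ∨ a = y then (if b = x ∨ b = y then r.rel a b else True)
    else if b = x ∨ b = y then False else r.rel a b
  total := by
    intro a b
    by_cases ha : a = x ∨ a = y <;> by_cases hb : b = x ∨ b = y <;>
      simp [ha, hb, r.total a b]
  trans := by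
    intro a b c hab hbc
    by_cases ha : a = x ∨ a = y <;> by_cases hb : b = x ∨ b = y <;>
      by_cases hc : c = x ∨ c = y <;> simp_all <;>
      exact r.trans _ _ _ hab hbc

/-- Relabelling the alternatives of a weak order by a permutation `σ`:
`a` is weakly preferred to `b` in `σ(r)` iff `σ⁻¹ a` is weakly preferred to `σ⁻¹ b` in `r`. -/
def map (σ : Equiv.Perm A) (r : WeakOrd A) : WeakOrd A where
  rel a b := r.rel (σ.symm a) (σ.symm b)
  total := fun _ _ => r.total _ _
  trans := fun _ _ _ hab hbc => r.trans _ _ _ hab hbc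

end WeakOrd

/-- A (preference) profile: a weak order for each voter. -/
abbrev Profile (N A : Type*) := N → WeakOrd A

namespace Profile

variable {N A : Type*}

/-- The top-shift profile `R^{x,y}`. -/
noncomputable def topShift (R : Profile N A) (x y : A) : Profile N A :=
  fun i => (R i).topShift x y

/-- Relabelling alternatives in every voter's preference by a permutation `σ`. -/
def map (σ : Equiv.Perm A) (R : Profile N A) : Profile N A := fun i => (R i).map σ

end Profile

/-- `nwins R x y` is `n(x,y,R)`, the number of voters strictly preferring `x` to `y`. -/
noncomputable def nwins {N A : Type*} (R : Profile N A) (x y : A) : ℕ :=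
  Nat.card {i // (R i).strict x y}

/-- The set of Condorcet winners of `R`. -/
def CW {N A : Type*} (R : Profile N A) : Set A :=
  {x | ∀ y, y ≠ x → nwins R y x ≤ nwins R x y}

/-- Condorcet consistency of a social decision rule. -/
def CondorcetConsistent {N A : Type*} (C : Profile N A → Set A) : Prop :=
  ∀ R : Profile N A, (CW R).Nonempty → C R = CW R

/-- The nice set `N_C(R)`: alternatives selected each time they are top-shifted with any
other alternative. -/
def niceSet {N A : Type*} (C : Profile N A → Set A) (R : Profile N A) : Set A :=
  {x | ∀ y, y ≠ x → x ∈ C (R.topShift x y)}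

/-- Weak top consistency (WTC). -/
def WeakTopConsistency {N A : Type*} (C : Profile N A → Set A) : Prop :=
  ∀ R : Profile N A, niceSet C R ⊆ C R

/-- Top consistency (TC). -/
def TopConsistency {N A : Type*} (C : Profile N A → Set A) : Prop :=
  ∀ R : Profile N A, (niceSet C R).Nonempty → C R = niceSet C R

/-- A 2-profile: two alternatives are unanimously strictly preferred to all others. -/
def IsTwoProfile {N A : Type*} (R : Profile N A) : Prop :=
  ∃ x y : A, x ≠ y ∧
    ∀ z, z ≠ x → z ≠ y → ∀ i, (R i).strict x z ∧ (R i).strict y z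

/-- Top anonymity (TA). -/
def TopAnonymity {N A : Type*} (C : Profile N A → Set A) : Prop :=
  ∀ R : Profile N A, IsTwoProfile R → ∀ π : Equiv.Perm N, C (fun i => R (π i)) = C R

/-- Top neutrality (TN). -/
def TopNeutrality {N A : Type*} (C : Profile N A → Set A) : Prop :=
  ∀ R : Profile N A, IsTwoProfile R → ∀ σ : Equiv.Perm A, C (Profile.map σ R) = σ '' (C R)

/-- Top symmetry (TS): top anonymity and top neutrality. -/
def TopSymmetry {N A : Type*} (C : Profile N A → Set A) : Prop :=
  TopAnonymity C ∧ TopNeutrality C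

/-- `Improves R Q x z`, i.e. `R ▷^{x,z} Q`: `Q` is an additional support of `x`
against `z` from `R` to `Q`. -/
def Improves {N A : Type*} (R Q : Profile N A) (x z : A) : Prop :=
  (∀ i w, ((R i).strict x w → (Q i).strict x w) ∧ ((R i).indiff x w → (Q i).rel x w)) ∧
  ∃ i, (R i).rel z x ∧ (Q i).strict x z

/-- Top monotonicity (TM). -/
def TopMonotonicity {N A : Type*} (C : Profile N A → Set A) : Prop :=
  ∀ (R Q : Profile N A) (x y z : A), x ≠ y → z ≠ x →
    x ∈ C (R.topShift x y) → Improves R Q x z →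
    x ∈ C (Q.topShift x y) ∧ z ∉ C (Q.topShift x y)

/-- Top rationality (TR). -/
def TopRationality {N A : Type*} (C : Profile N A → Set A) : Prop :=
  ∀ (R : Profile N A) (x y : A), x ≠ y → (C (R.topShift x y) ∩ {x, y}).Nonempty

/-- Maskin monotonicity (MM). -/
def MaskinMonotonic {N A : Type*} (C : Profile N A → Set A) : Prop :=
  ∀ (R Q : Profile N A) (x : A), x ∈ C R →
    (∀ i y, ((R i).strict x y → (Q i).strict x y) ∧ ((R i).indiff x y → (Q i).rel x y)) →
    x ∈ C Q

theorem WeakOrd.topShift_strict_pair {A : Type*} (r : WeakOrd A) (x y : A) :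
    ((r.topShift x y).strict x y ↔ r.strict x y) ∧
      ((r.topShift x y).strict y x ↔ r.strict y x) := by
  simp [WeakOrd.strict, WeakOrd.topShift]

theorem nwins_topShift_left {N A : Type*} (R : Profile N A) (x y : A) :
    nwins (R.topShift x y) x y = nwins R x y := by
  simp only [nwins, Profile.topShift, WeakOrd.topShift_strict_pair]

theorem nwins_topShift_right {N A : Type*} (R : Profile N A) (x y : A) :
    nwins (R.topShift x y) y x = nwins R y x := by
  simp only [nwins, Profile.topShift, WeakOrd.topShift_strict_pair]

theorem nwins_topShift_other {N A : Type*} (R : Profile N A) {x y z w : A} (hz : z ≠ x ∧ z ≠ y)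
    (hw : w = x ∨ w = y) : nwins (R.topShift x y) z w = 0 := by
  simp [nwins, Profile.topShift, WeakOrd.strict, WeakOrd.topShift, hz.1, hz.2, hw]

theorem mem_CW_topShift_left_iff {N A : Type*} (R : Profile N A) {x y : A} (hxy : y ≠ x) :
    x ∈ CW (R.topShift x y) ↔ nwins R y x ≤ nwins R x y := by
  rw [← nwins_topShift_left R x y, ← nwins_topShift_right R x y]
  refine ⟨fun h => h y hxy, fun h z hz => ?_⟩
  by_cases hzy : z = y
  · rwa [hzy]
  · simp [nwins_topShift_other R ⟨hz, hzy⟩ (Or.inl rfl)]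

theorem mem_CW_topShift_right_iff {N A : Type*} (R : Profile N A) {x y : A} (hxy : x ≠ y) :
    y ∈ CW (R.topShift x y) ↔ nwins R x y ≤ nwins R y x := by
  rw [← nwins_topShift_left R x y, ← nwins_topShift_right R x y]
  refine ⟨fun h => h x hxy, fun h z hz => ?_⟩
  by_cases hzx : z = x
  · rwa [hzx]
  · simp [nwins_topShift_other R ⟨hzx, hz⟩ (Or.inr rfl)]

theorem CW_topShift_nonempty {N A : Type*} (R : Profile N A) {x y : A} (hxy : y ≠ x) :
    (CW (R.topShift x y)).Nonempty := by
  rcases le_total (nwins R y x) (nwins R x y) with h | h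
  · exact ⟨x, (mem_CW_topShift_left_iff R hxy).2 h⟩
  · exact ⟨y, (mem_CW_topShift_right_iff R hxy.symm).2 h⟩

/-- The nice set of a Condorcet-consistent rule is the set of Condorcet winners. -/
theorem CondorcetConsistent.niceSet_eq {N A : Type*} {C : Profile N A → Set A}
    (hCC : CondorcetConsistent C) (R : Profile N A) : niceSet C R = CW R := by
  ext x
  refine forall₂_congr fun y hy => ?_
  rw [hCC _ (CW_topShift_nonempty R hy), mem_CW_topShift_left_iff R hy]

/-- Every Condorcet-consistent social decision rule satisfies
top consistency. -/
theorem stmt_0 {N A : Type*} [Fintype N] [Fintype A]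
    (hN : 2 ≤ Fintype.card N) (hA : 3 ≤ Fintype.card A)
    (C : Profile N A → Set A) (hCne : ∀ R, (C R).Nonempty)
    (hCC : CondorcetConsistent C) :
    TopConsistency C := by
  intro R hR
  rw [hCC.niceSet_eq R] at hR ⊢
  exact hCC R hR
end

section
/- Assume m ≥ 3, n ≥ 2 and n ≠ 3. Then every L-scoring SDR fails to satisfy top consistency: for any scoring vector α and any SDR C with C(R) = C_α(R) on all linear-order profiles, there exists a profile R of linear orders such that N_C(R) ≠ ∅ and C(R) ≠ N_C(R). -/
/-- A profile of linear orders: each voter's weak order is antisymmetric. -/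
def IsLinearProfile {N A : Type*} (R : Profile N A) : Prop :=
  ∀ i : N, ∀ a b : A, (R i).rel a b → (R i).rel b a → a = b

/-- The rank `rg(x, r)` of `x` in `r`: the number of alternatives weakly preferred
to `x`. -/
noncomputable def rg {A : Type*} (r : WeakOrd A) (x : A) : ℕ :=
  Nat.card {y // r.rel y x}

/-- The score of `x` in the profile `R` with respect to the scoring vector `α`. -/
noncomputable def score {N A : Type*} [Fintype N] (α : ℕ → ℝ)
    (R : Profile N A) (x : A) : ℝ :=
  ∑ i : N, α (rg (R i) x)

/-- The set of alternatives with maximal score, `C_α(R)`. -/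
def scoreWinners {N A : Type*} [Fintype N] (α : ℕ → ℝ) (R : Profile N A) : Set A :=
  {x | ∀ y : A, score α R y ≤ score α R x}

namespace WeakOrd

variable {A : Type*} {m : ℕ}

/-- The linear order in which `x` occupies the position `σ x`. -/
def ofEquiv (σ : A ≃ Fin m) : WeakOrd A where
  rel x y := σ x ≤ σ y
  total _ _ := le_total _ _
  trans _ _ _ := le_trans

theorem rg_ofEquiv (σ : A ≃ Fin m) (x : A) : rg (ofEquiv σ) x = (σ x : ℕ) + 1 := by
  have h : Nat.card {y // σ y ≤ σ x} = Nat.card {j : Fin m // j ≤ σ x} :=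
    Nat.card_congr (σ.subtypeEquiv fun _ => Iff.rfl)
  unfold rg ofEquiv
  rw [h, Nat.card_eq_fintype_card, Fintype.card_subtype]
  have : (Finset.univ.filter fun j : Fin m => j ≤ σ x) = Finset.Iic (σ x) := by
    ext; simp
  rw [this, Fin.card_Iic]

theorem rg_le_card [Fintype A] (r : WeakOrd A) (x : A) : rg r x ≤ Fintype.card A := by
  rw [← Nat.card_eq_fintype_card]
  exact Finite.card_subtype_le _

theorem rg_topShift_left (σ : A ≃ Fin m) {x y : A} (hxy : x ≠ y) :
    rg ((ofEquiv σ).topShift x y) x = if σ x < σ y then 1 else 2 := by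
  have hset : {z | ((ofEquiv σ).topShift x y).rel z x} =
      if σ x < σ y then {x} else {x, y} := by
    ext z
    split_ifs with h <;> by_cases hzx : z = x <;> by_cases hzy : z = y <;>
      simp_all [topShift, ofEquiv]
  change Set.ncard {z | ((ofEquiv σ).topShift x y).rel z x} = _
  rw [hset]
  split_ifs
  · exact Set.ncard_singleton x
  · exact Set.ncard_pair hxy

theorem topShift_comm (r : WeakOrd A) (x y : A) : r.topShift x y = r.topShift y x := by
  simp only [topShift, mk.injEq]
  funext a b
  congr! 1
  · exact or_comm
  all_goals congr! 1; exact or_comm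

theorem two_le_rg_topShift [Finite A] (r : WeakOrd A) {x y z : A} (hxy : x ≠ y)
    (hzx : z ≠ x) (hzy : z ≠ y) : 2 ≤ rg (r.topShift x y) z := by
  change 2 ≤ Set.ncard {w | (r.topShift x y).rel w z}
  rw [← Set.ncard_pair hxy]
  refine Set.ncard_le_ncard ?_ (Set.toFinite _)
  rintro w (rfl | rfl) <;> simp [topShift, hzx, hzy]

theorem topShift_antisymm (r : WeakOrd A) (h : ∀ a b, r.rel a b → r.rel b a → a = b)
    (x y a b : A) (hab : (r.topShift x y).rel a b) (hba : (r.topShift x y).rel b a) :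
    a = b := by
  by_cases ha : a = x ∨ a = y <;> by_cases hb : b = x ∨ b = y <;>
    simp only [topShift, ha, hb, if_true, if_false] at hab hba
  all_goals exact h a b hab hba

end WeakOrd

open WeakOrd

theorem isLinearProfile_ofEquiv {N A : Type*} {m : ℕ} (L : N → A ≃ Fin m) :
    IsLinearProfile fun i => ofEquiv (L i) :=
  fun i _ _ hab hba => (L i).injective (le_antisymm hab hba)

section Scoring

variable {N A : Type*} [Fintype N] {m : ℕ}

/-- The number of voters placing `x` before `y` minus the number of the others. -/
noncomputable def margin (L : N → A ≃ Fin m) (x y : A) : ℝ :=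
  ∑ i, if L i x < L i y then 1 else -1

theorem score_ofEquiv (α : ℕ → ℝ) (L : N → A ≃ Fin m) (x : A) :
    score α (fun i => ofEquiv (L i)) x = ∑ i, α ((L i x : ℕ) + 1) := by
  simp only [score, rg_ofEquiv]

theorem score_topShift_left (α : ℕ → ℝ) (L : N → A ≃ Fin m) {x y : A} (hxy : x ≠ y) :
    score α (Profile.topShift (fun i => ofEquiv (L i)) x y) x =
      ∑ i, if L i x < L i y then α 1 else α 2 := by
  simp only [score, Profile.topShift, rg_topShift_left _ hxy, apply_ite α]

theorem score_topShift_sub (α : ℕ → ℝ) (L : N → A ≃ Fin m) {x y : A} (hxy : x ≠ y) :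
    score α (Profile.topShift (fun i => ofEquiv (L i)) x y) x -
      score α (Profile.topShift (fun i => ofEquiv (L i)) x y) y =
      (α 1 - α 2) * margin L x y := by
  have hcomm : Profile.topShift (fun i => ofEquiv (L i)) x y =
      Profile.topShift (fun i => ofEquiv (L i)) y x :=
    funext fun i => topShift_comm _ x y
  rw [score_topShift_left α L hxy, hcomm, score_topShift_left α L hxy.symm, margin,
    Finset.mul_sum, ← Finset.sum_sub_distrib]
  refine Finset.sum_congr rfl fun i _ => ?_
  have hne : L i x ≠ L i y := fun h => hxy ((L i).injective h)
  rcases lt_or_gt_of_ne hne with h | h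
  · simp [h, h.not_gt]
  · simp [h, h.not_gt]

variable [Fintype A]

theorem score_topShift_other_le {α : ℕ → ℝ} (h2 : 2 ≤ Fintype.card A)
    (hα : ∀ i j : ℕ, 1 ≤ i → i ≤ j → j ≤ Fintype.card A → α j ≤ α i)
    (L : N → A ≃ Fin m) {x y z : A} (hxy : x ≠ y) (hzx : z ≠ x) (hzy : z ≠ y) :
    score α (Profile.topShift (fun i => ofEquiv (L i)) x y) z ≤
      score α (Profile.topShift (fun i => ofEquiv (L i)) x y) x := by
  rw [score_topShift_left α L hxy]
  refine Finset.sum_le_sum fun i _ => ?_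
  have hz : α (rg ((ofEquiv (L i)).topShift x y) z) ≤ α 2 :=
    hα _ _ (by norm_num) (two_le_rg_topShift _ hxy hzx hzy) (rg_le_card _ _)
  have h12 : α 2 ≤ α 1 := hα 1 2 le_rfl (by norm_num) h2
  change α (rg ((ofEquiv (L i)).topShift x y) z) ≤ _
  split_ifs <;> linarith

theorem mem_scoreWinners_topShift_iff {α : ℕ → ℝ} (h2 : 2 ≤ Fintype.card A)
    (hα : ∀ i j : ℕ, 1 ≤ i → i ≤ j → j ≤ Fintype.card A → α j ≤ α i)
    (L : N → A ≃ Fin m) {x y : A} (hxy : x ≠ y) :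
    x ∈ scoreWinners α (Profile.topShift (fun i => ofEquiv (L i)) x y) ↔
      0 ≤ (α 1 - α 2) * margin L x y := by
  rw [← score_topShift_sub α L hxy, sub_nonneg]
  refine ⟨fun h => h y, fun h z => ?_⟩
  by_cases hzx : z = x
  · rw [hzx]
  by_cases hzy : z = y
  · rwa [hzy]
  exact score_topShift_other_le h2 hα L hxy hzx hzy

theorem mem_niceSet_iff {α : ℕ → ℝ} (h2 : 2 ≤ Fintype.card A)
    (hα : ∀ i j : ℕ, 1 ≤ i → i ≤ j → j ≤ Fintype.card A → α j ≤ α i)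
    {C : Profile N A → Set A}
    (hC : ∀ R : Profile N A, IsLinearProfile R → C R = scoreWinners α R)
    (L : N → A ≃ Fin m) (x : A) :
    x ∈ niceSet C (fun i => ofEquiv (L i)) ↔
      ∀ y, y ≠ x → 0 ≤ (α 1 - α 2) * margin L x y := by
  refine forall₂_congr fun y hy => ?_
  rw [hC, mem_scoreWinners_topShift_iff h2 hα L hy.symm]
  exact fun i => topShift_antisymm _ (isLinearProfile_ofEquiv L i) x y

/-- Top consistency fails if `a` is a Condorcet winner with a smaller score than `b`, or
if the scores may tie but `b` is beaten by `a`. -/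
theorem exists_failure_of_margin {α : ℕ → ℝ} (h2 : 2 ≤ Fintype.card A)
    (hα : ∀ i j : ℕ, 1 ≤ i → i ≤ j → j ≤ Fintype.card A → α j ≤ α i) (h12 : α 2 < α 1)
    {C : Profile N A → Set A}
    (hC : ∀ R : Profile N A, IsLinearProfile R → C R = scoreWinners α R)
    (L : N → A ≃ Fin m) {a b : A} (hab : a ≠ b) (ha : ∀ y, y ≠ a → 0 ≤ margin L a y)
    (hb : ∑ i, α ((L i a : ℕ) + 1) < ∑ i, α ((L i b : ℕ) + 1) ∨
      ∑ i, α ((L i a : ℕ) + 1) ≤ ∑ i, α ((L i b : ℕ) + 1) ∧ margin L b a < 0) :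
    ∃ R : Profile N A, IsLinearProfile R ∧ (niceSet C R).Nonempty ∧ C R ≠ niceSet C R := by
  have ha' : a ∈ niceSet C (fun i => ofEquiv (L i)) :=
    (mem_niceSet_iff h2 hα hC L a).2 fun y hy => mul_nonneg (by linarith) (ha y hy)
  refine ⟨_, isLinearProfile_ofEquiv L, ⟨a, ha'⟩, fun heq => ?_⟩
  have hw := hC _ (isLinearProfile_ofEquiv L)
  have haC : a ∈ scoreWinners α (fun i => ofEquiv (L i)) := by rwa [← hw, heq]
  rw [← score_ofEquiv, ← score_ofEquiv] at hb
  rcases hb with hlt | ⟨hle, hm⟩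
  · exact absurd (haC b) (not_le.2 hlt)
  · have hbC : b ∈ niceSet C (fun i => ofEquiv (L i)) := by
      rw [← heq, hw]
      exact fun y => (haC y).trans hle
    have := (mem_niceSet_iff h2 hα hC L b).1 hbC a hab
    nlinarith

theorem exists_failure_of_tie [Nonempty N] {α : ℕ → ℝ} (h2 : 2 ≤ Fintype.card A)
    (hα : ∀ i j : ℕ, 1 ≤ i → i ≤ j → j ≤ Fintype.card A → α j ≤ α i) (h12 : α 1 = α 2)
    (hlast : α (Fintype.card A) < α 1) {C : Profile N A → Set A}
    (hC : ∀ R : Profile N A, IsLinearProfile R → C R = scoreWinners α R) :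
    ∃ R : Profile N A, IsLinearProfile R ∧ (niceSet C R).Nonempty ∧ C R ≠ niceSet C R := by
  obtain ⟨k, hk⟩ : ∃ k, Fintype.card A = k + 1 := ⟨Fintype.card A - 1, by omega⟩
  let L : N → A ≃ Fin (k + 1) := fun _ => Fintype.equivFinOfCardEq hk
  have hnice : ∀ x, x ∈ niceSet C (fun i => ofEquiv (L i)) := fun x =>
    (mem_niceSet_iff h2 hα hC L x).2 fun y _ => by simp [h12]
  refine ⟨_, isLinearProfile_ofEquiv L, ⟨_, hnice ((Fintype.equivFinOfCardEq hk).symm 0)⟩,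
    fun heq => ?_⟩
  have hmem := hnice ((Fintype.equivFinOfCardEq hk).symm (Fin.last k))
  rw [← heq, hC _ (isLinearProfile_ofEquiv L)] at hmem
  have hle := hmem ((Fintype.equivFinOfCardEq hk).symm 0)
  rw [score_ofEquiv, score_ofEquiv] at hle
  refine absurd hle (not_le.2 (Finset.sum_lt_sum_of_nonempty Finset.univ_nonempty ?_))
  intro i _
  simpa [L, ← hk] using hlast

end Scoring

/-- There is a linear order with two prescribed positions. -/
theorem Equiv.exists_apply_eq_and_apply_eq {A B : Type*} [DecidableEq B] (e : A ≃ B)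
    {a b : A} {u v : B} (hab : a ≠ b) (huv : u ≠ v) :
    ∃ σ : A ≃ B, σ a = u ∧ σ b = v := by
  let τ := e.trans (Equiv.swap (e a) u)
  have hτ : τ a = u := by simp [τ]
  have hne : u ≠ τ b := fun h => hab (τ.injective (hτ.trans h))
  refine ⟨τ.trans (Equiv.swap (τ b) v), ?_, by simp⟩
  rw [Equiv.trans_apply, hτ, Equiv.swap_apply_of_ne_of_ne hne huv]

/-- A finite index set can be split into three classes of prescribed sizes. -/
theorem exists_fun_sum_eq {N β : Type*} [Fintype N] {p q r : ℕ}
    (h : p + q + r = Fintype.card N) (s t u : β) :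
    ∃ L : N → β, ∀ g : β → ℝ, ∑ i, g (L i) = p * g s + q * g t + r * g u := by
  have hcard : Fintype.card N = Fintype.card ((Fin p ⊕ Fin q) ⊕ Fin r) := by simp [h]
  let e := Fintype.equivOfCardEq hcard
  refine ⟨fun i => Sum.elim (Sum.elim (fun _ => s) fun _ => t) (fun _ => u) (e i), fun g => ?_⟩
  rw [e.sum_comp fun j => g (Sum.elim (Sum.elim (fun _ => s) fun _ => t) (fun _ => u) j)]
  simp

/-- For `m ≥ 3`, `n ≥ 2`, `n ≠ 3`, every `L`-scoring SDR fails top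
consistency: there is a profile of linear orders whose nice set is nonempty and
differs from the winning set. -/
theorem stmt_2 {N A : Type*} [Fintype N] [Fintype A]
    (hN2 : 2 ≤ Fintype.card N) (hN3 : Fintype.card N ≠ 3)
    (hA : 3 ≤ Fintype.card A)
    (α : ℕ → ℝ)
    (hαmono : ∀ i j : ℕ, 1 ≤ i → i ≤ j → j ≤ Fintype.card A → α j ≤ α i)
    (hαstrict : α (Fintype.card A) < α 1)
    (C : Profile N A → Set A) (hCne : ∀ R, (C R).Nonempty)
    (hscoring : ∀ R : Profile N A, IsLinearProfile R → C R = scoreWinners α R) :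
    ∃ R : Profile N A, IsLinearProfile R ∧
      (niceSet C R).Nonempty ∧ C R ≠ niceSet C R := by
  have h12 : α 2 ≤ α 1 := hαmono 1 2 le_rfl (by norm_num) (by omega)
  have h2m : α (Fintype.card A) ≤ α 2 := hαmono 2 _ (by norm_num) (by omega) le_rfl
  have hne : Nonempty N := Fintype.card_pos_iff.1 (by omega)
  rcases h12.eq_or_lt' with heq | hlt
  · exact exists_failure_of_tie (by omega) hαmono heq hαstrict hscoring
  obtain ⟨m, hm⟩ : ∃ m, Fintype.card A = m + 3 := ⟨Fintype.card A - 3, by omega⟩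
  let e : A ≃ Fin (m + 3) := Fintype.equivFinOfCardEq hm
  let a := e.symm 0
  let b := e.symm 1
  let c := e.symm ⟨2, by omega⟩
  have hab : a ≠ b := by simp [a, b]
  have hac : a ≠ c := by simp [a, c, Fin.ext_iff]
  have hbc : b ≠ c := by simp [b, c, Fin.ext_iff]
  have h01 : (0 : Fin (m + 3)) ≠ 1 := by simp
  have h0l : (0 : Fin (m + 3)) ≠ Fin.last _ := by simp [Fin.ext_iff]
  obtain ⟨σ₁, h₁b, h₁a⟩ := e.exists_apply_eq_and_apply_eq hab.symm h01
  obtain ⟨σ₂, h₂c, h₂a⟩ := e.exists_apply_eq_and_apply_eq hac.symm h01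
  obtain ⟨σ₃, h₃a, h₃b⟩ := e.exists_apply_eq_and_apply_eq hab h01
  obtain ⟨σ₄, h₄b, h₄a⟩ := e.exists_apply_eq_and_apply_eq hab.symm h0l
  have hsecond : ∀ (σ : A ≃ Fin (m + 3)) (d y : A), σ d = 0 → σ a = 1 → y ≠ a → y ≠ d →
      σ a < σ y := by
    intro σ d y hd ha hya hyd
    have hy0 : σ y ≠ 0 := fun h => hyd (σ.injective (h.trans hd.symm))
    have hy1 : σ y ≠ 1 := fun h => hya (σ.injective (h.trans ha.symm))
    rw [ha, Fin.lt_def]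
    simp only [ne_eq, Fin.ext_iff, Fin.val_zero, Fin.val_one] at hy0 hy1 ⊢
    omega
  have hfirst : ∀ y, y ≠ a → σ₃ a < σ₃ y := by
    intro y hya
    rw [h₃a, Fin.pos_iff_ne_zero]
    exact fun h => hya (σ₃.injective (h.trans h₃a.symm))
  have hlast : ∀ y, ¬ σ₄ a < σ₄ y := fun y => by
    rw [h₄a]; exact not_lt.2 (Fin.le_last _)
  have h₂b : α (m + 3) ≤ α ((σ₂ b : ℕ) + 1) :=
    hαmono _ _ (by omega) (by omega) hm.ge
  rw [hm] at h2m hαstrict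
  have hwinner₁₂ : ∀ (k r : ℕ) (L : N → A ≃ Fin (m + 3)),
      (∀ g : (A ≃ Fin (m + 3)) → ℝ, ∑ i, g (L i) = k * g σ₁ + k * g σ₂ + r * g σ₃) →
      ∀ y, y ≠ a → 0 ≤ margin L a y := by
    intro k r L hL y hy
    have hk : (0 : ℝ) ≤ k := k.cast_nonneg
    have hr : (0 : ℝ) ≤ r := r.cast_nonneg
    rw [margin, hL fun σ => if σ a < σ y then 1 else -1, if_pos (hfirst y hy)]
    by_cases hyb : y = b
    · rw [if_pos (hsecond σ₂ c y h₂c h₂a hy (hyb ▸ hbc))]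
      split_ifs <;> linarith
    · rw [if_pos (hsecond σ₁ b y h₁b h₁a hy hyb)]
      split_ifs <;> linarith
  have hwinner₃₄ : ∀ (p k : ℕ) (L : N → A ≃ Fin (m + 3)), k ≤ p →
      (∀ g : (A ≃ Fin (m + 3)) → ℝ, ∑ i, g (L i) = p * g σ₃ + k * g σ₄ + (0 : ℕ) * g σ₄) →
      ∀ y, y ≠ a → 0 ≤ margin L a y := by
    intro p k L hkp hL y hy
    have hkp' : (k : ℝ) ≤ p := by exact_mod_cast hkp
    rw [margin, hL fun σ => if σ a < σ y then 1 else -1, if_pos (hfirst y hy),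
      if_neg (hlast y)]
    push_cast
    linarith
  have hA2 : 2 ≤ Fintype.card A := by omega
  rcases Nat.even_or_odd' (Fintype.card N) with ⟨k, hk | hk⟩
  · have hkpos : (0 : ℝ) < k := by exact_mod_cast (by omega : 0 < k)
    rcases h2m.eq_or_lt with h2 | h2
    · obtain ⟨L, hL⟩ := exists_fun_sum_eq (show k + k + 0 = Fintype.card N by omega) σ₁ σ₂ σ₃
      refine exists_failure_of_margin hA2 hαmono hlt hscoring L hab (hwinner₁₂ k 0 L hL)
        (Or.inl ?_)
      rw [hL fun σ => α ((σ a : ℕ) + 1), hL fun σ => α ((σ b : ℕ) + 1)]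
      simp only [h₁a, h₂a, h₁b, Fin.val_zero, Fin.val_one, zero_add, Nat.reduceAdd,
        Nat.cast_zero, zero_mul, add_zero]
      nlinarith
    · obtain ⟨L, hL⟩ := exists_fun_sum_eq (show k + k + 0 = Fintype.card N by omega) σ₃ σ₄ σ₄
      refine exists_failure_of_margin hA2 hαmono hlt hscoring L hab
        (hwinner₃₄ k k L le_rfl hL) (Or.inl ?_)
      rw [hL fun σ => α ((σ a : ℕ) + 1), hL fun σ => α ((σ b : ℕ) + 1)]
      simp only [h₃a, h₄a, h₃b, h₄b, Fin.val_zero, Fin.val_one, Fin.val_last, zero_add,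
        Nat.reduceAdd, Nat.cast_zero, zero_mul, add_zero, add_assoc]
      nlinarith
  · have hk2 : (2 : ℝ) ≤ k := by exact_mod_cast (by omega : 2 ≤ k)
    by_cases hcmp : (2 * k - 1) * α 2 < (k - 1) * α 1 + k * α (m + 3)
    · obtain ⟨L, hL⟩ := exists_fun_sum_eq (show k + k + 1 = Fintype.card N by omega) σ₁ σ₂ σ₃
      refine exists_failure_of_margin hA2 hαmono hlt hscoring L hab (hwinner₁₂ k 1 L hL)
        (Or.inl ?_)
      rw [hL fun σ => α ((σ a : ℕ) + 1), hL fun σ => α ((σ b : ℕ) + 1)]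
      simp only [h₁a, h₂a, h₃a, h₁b, h₃b, Fin.val_zero, Fin.val_one, zero_add, Nat.reduceAdd,
        Nat.cast_one, one_mul]
      nlinarith
    · obtain ⟨L, hL⟩ :=
        exists_fun_sum_eq (show (k + 1) + k + 0 = Fintype.card N by omega) σ₃ σ₄ σ₄
      refine exists_failure_of_margin hA2 hαmono hlt hscoring L hab
        (hwinner₃₄ (k + 1) k L (by omega) hL) (Or.inr ⟨?_, ?_⟩)
      · rw [hL fun σ => α ((σ a : ℕ) + 1), hL fun σ => α ((σ b : ℕ) + 1)]
        simp only [h₃a, h₄a, h₃b, h₄b, Fin.val_zero, Fin.val_one, Fin.val_last, zero_add,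
          Nat.reduceAdd, Nat.cast_zero, zero_mul, add_zero, add_assoc]
        push_cast
        have hu : 0 < α 1 - α (m + 3) := by linarith
        have hv : (k - 1) * (α 1 - α (m + 3)) ≤ (2 * k - 1) * (α 2 - α (m + 3)) := by
          linarith
        have hk3 : (0 : ℝ) ≤ k * (k - 2) * (α 1 - α (m + 3)) :=
          mul_nonneg (mul_nonneg (by linarith) (by linarith)) hu.le
        have hkey : α 1 - α (m + 3) ≤ (k + 1) * (α 2 - α (m + 3)) := by
          refine le_of_mul_le_mul_left ?_ (by linarith : (0 : ℝ) < 2 * k - 1)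
          linarith [mul_le_mul_of_nonneg_left hv (by linarith : (0 : ℝ) ≤ k + 1)]
        linarith
      · rw [margin, hL fun σ => if σ b < σ a then 1 else -1, if_neg (hfirst b hab.symm).not_gt]
        split_ifs <;> push_cast <;> linarith
end

section
/- If an SDR C satisfies weak top consistency (WTC), top monotonicity (TM), top symmetry (TS) and top rationality (TR), then every Condorcet winner is selected: for every profile R, CW(R) ⊆ C(R). -/
namespace WeakOrd

variable {A : Type*}

theorem eq_of_rel_iff {r s : WeakOrd A} (h : ∀ a b, r.rel a b ↔ s.rel a b) : r = s := by
  cases r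
  cases s
  congr 1
  ext a b
  exact h a b

open Classical in
/-- The weak order obtained from `r` by moving `x` and `y` strictly below all other
alternatives, preserving the relative ranking of `x` and `y` and of the rest. -/
noncomputable def bottomShift (r : WeakOrd A) (x y : A) : WeakOrd A where
  rel a b :=
    if a = x ∨ a = y then (if b = x ∨ b = y then r.rel a b else False)
    else if b = x ∨ b = y then True else r.rel a b
  total := by
    intro a b
    by_cases ha : a = x ∨ a = y <;> by_cases hb : b = x ∨ b = y <;>
      simp [ha, hb, r.total a b]
  trans := by
    intro a b c hab hbc
    by_cases ha : a = x ∨ a = y <;> by_cases hb : b = x ∨ b = y <;>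
      by_cases hc : c = x ∨ c = y <;> simp_all <;>
      exact r.trans _ _ _ hab hbc

theorem topShift_bottomShift (r : WeakOrd A) (x y : A) :
    (r.bottomShift x y).topShift x y = r.topShift x y := by
  apply eq_of_rel_iff
  intro a b
  by_cases ha : a = x ∨ a = y <;> by_cases hb : b = x ∨ b = y <;>
    simp only [topShift, bottomShift, ha, hb, if_true, if_false]

theorem topShift_topShift (r : WeakOrd A) (x y : A) :
    (r.topShift x y).topShift x y = r.topShift x y := by
  apply eq_of_rel_iff
  intro a b
  by_cases ha : a = x ∨ a = y <;> by_cases hb : b = x ∨ b = y <;>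
    simp only [topShift, ha, hb, if_true, if_false]

theorem topShift_rel_left_right (r : WeakOrd A) (x y : A) :
    (r.topShift x y).rel x y ↔ r.rel x y := by
  simp [topShift]

theorem topShift_rel_right_left (r : WeakOrd A) (x y : A) :
    (r.topShift x y).rel y x ↔ r.rel y x := by
  simp [topShift]

open Classical in
theorem topShift_map_swap (r : WeakOrd A) (x y : A) :
    ((r.topShift x y).map (Equiv.swap x y)).topShift x y =
      (r.topShift x y).map (Equiv.swap x y) := by
  have key : ∀ a, (Equiv.swap x y a = x ∨ Equiv.swap x y a = y) ↔ (a = x ∨ a = y) := by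
    intro a
    rw [Equiv.swap_apply_eq_iff, Equiv.swap_apply_eq_iff, Equiv.swap_apply_left,
      Equiv.swap_apply_right, or_comm]
  apply eq_of_rel_iff
  intro a b
  by_cases ha : a = x ∨ a = y <;> by_cases hb : b = x ∨ b = y <;>
    simp only [topShift, map, Equiv.symm_swap, key, ha, hb, if_true, if_false]

end WeakOrd

theorem Profile.isTwoProfile_topShift {N A : Type*} (R : Profile N A) {x y : A} (hxy : x ≠ y) :
    IsTwoProfile (R.topShift x y) := by
  refine ⟨x, y, hxy, fun z hzx hzy i => ?_⟩
  simp [Profile.topShift, WeakOrd.topShift, WeakOrd.strict, hzx, hzy]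

theorem exists_perm_of_card_subtype_le {N : Type*} [Finite N] {p q : N → Prop}
    (hpq : ∀ i, p i → ¬ q i) (h : Nat.card {i // p i} ≤ Nat.card {i // q i}) :
    ∃ π : Equiv.Perm N, (∀ i, p i → q (π i)) ∧ ∀ i, p (π i) → q i := by
  classical
  have := Fintype.ofFinite N
  rw [Nat.card_eq_fintype_card, Nat.card_eq_fintype_card] at h
  obtain ⟨e⟩ := Function.Embedding.nonempty_of_card_le h
  let g : N → N := fun i =>
    if hp : p i then e ⟨i, hp⟩ else if hi : ∃ t, (e t : N) = i then (hi.choose : N) else i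
  have g_of_p (t : {i // p i}) : g t = e t := by simp [g, t.2]
  have g_image (t : {i // p i}) : g (e t) = t := by
    have hp : ¬ p (e t : N) := fun hp => hpq _ hp (e t).2
    have hi : ∃ s, (e s : N) = e t := ⟨t, rfl⟩
    have hs := e.injective (Subtype.ext hi.choose_spec)
    simp only [g, hp, dif_neg, not_false_eq_true, dif_pos hi, hs]
  have g_else (i : N) (hp : ¬ p i) (hi : ¬ ∃ t, (e t : N) = i) : g i = i := by
    simp only [g, dif_neg hp, dif_neg hi]
  have hg : Function.Involutive g := by
    intro i
    by_cases hp : p i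
    · rw [g_of_p ⟨i, hp⟩, g_image]
    · by_cases hi : ∃ t, (e t : N) = i
      · obtain ⟨t, rfl⟩ := hi
        rw [g_image, g_of_p]
      · rw [g_else i hp hi, g_else i hp hi]
  have hq (i : N) (hp : p i) : q (g i) := by
    rw [g_of_p ⟨i, hp⟩]
    exact (e _).2
  refine ⟨hg.toPerm g, hq, fun i hi => ?_⟩
  simpa only [hg i] using hq (g i) hi

/-- On top-shift profiles, membership of `x` is preserved as long as the position of `x` relative
to `y` does not deteriorate for any voter; how the other alternatives are ranked is irrelevant. -/
theorem TopMonotonicity.mem_topShift {N A : Type*} [Nonempty N] [Fintype A]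
    (hA : 3 ≤ Fintype.card A) {C : Profile N A → Set A} (hTM : TopMonotonicity C)
    {P Q : Profile N A} {x y : A} (hxy : x ≠ y) (hx : x ∈ C (P.topShift x y))
    (hstrict : ∀ i, (P i).strict x y → (Q i).strict x y)
    (hindiff : ∀ i, (P i).indiff x y → (Q i).rel x y) :
    x ∈ C (Q.topShift x y) := by
  classical
  obtain ⟨z, hzx, hzy⟩ : ∃ z, z ≠ x ∧ z ≠ y := by
    obtain ⟨z, hz⟩ := Finset.exists_mem_notMem_of_card_lt_card
      (s := {x, y}) (t := Finset.univ)
      (lt_of_le_of_lt Finset.card_le_two (by rw [Finset.card_univ]; omega))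
    exact ⟨z, by simpa using hz.2⟩
  have hP : Profile.topShift (fun i => (P i).bottomShift x y) x y = P.topShift x y :=
    funext fun i => (P i).topShift_bottomShift x y
  have hQ : (Q.topShift x y).topShift x y = Q.topShift x y :=
    funext fun i => (Q i).topShift_topShift x y
  rw [← hP] at hx
  rw [← hQ]
  refine (hTM _ _ x y z hxy hzx hx ⟨fun i w => ?_, ?_⟩).1
  · have h₁ := hstrict i
    have h₂ := hindiff i
    have h₃ := (Q i).total x x
    simp only [WeakOrd.strict, WeakOrd.indiff] at h₁ h₂
    by_cases hwx : w = x
    · subst hwx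
      simp [Profile.topShift, WeakOrd.topShift, WeakOrd.bottomShift, WeakOrd.strict,
        WeakOrd.indiff]
      tauto
    · by_cases hwy : w = y
      · subst hwy
        simp [Profile.topShift, WeakOrd.topShift, WeakOrd.bottomShift, WeakOrd.strict,
          WeakOrd.indiff]
        tauto
      · simp [Profile.topShift, WeakOrd.topShift, WeakOrd.bottomShift, WeakOrd.strict,
          WeakOrd.indiff, hwx, hwy]
  · obtain ⟨i⟩ := ‹Nonempty N›
    refine ⟨i, ?_⟩
    simp [Profile.topShift, WeakOrd.topShift, WeakOrd.bottomShift, WeakOrd.strict, hzx, hzy]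

/-- If an SDR satisfies WTC, TM, TS and TR, then every Condorcet
winner is selected. -/
theorem stmt_5 {N A : Type*} [Fintype N] [Fintype A]
    (hN : 2 ≤ Fintype.card N) (hA : 3 ≤ Fintype.card A)
    (C : Profile N A → Set A) (hCne : ∀ R, (C R).Nonempty)
    (hWTC : WeakTopConsistency C) (hTM : TopMonotonicity C)
    (hTS : TopSymmetry C) (hTR : TopRationality C) :
    ∀ R : Profile N A, CW R ⊆ C R := by
  classical
  have : Nonempty N := Fintype.card_pos_iff.mp (by omega)
  refine fun R x hx => hWTC R fun y hyx => ?_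
  obtain ⟨w, hw, rfl | rfl⟩ := hTR R x y hyx.symm
  · exact hw
  obtain ⟨π, hπ, hπ'⟩ := exists_perm_of_card_subtype_le
    (p := fun i => (R i).strict w x) (q := fun i => (R i).strict x w)
    (fun i h h' => h.2 h'.1) (hx w hyx)
  have hTwo := R.isTwoProfile_topShift hyx.symm
  have hTwo' := Profile.isTwoProfile_topShift (fun i => R (π i)) hyx.symm
  let P : Profile N A :=
    Profile.map (Equiv.swap x w) (Profile.topShift (fun i => R (π i)) x w)
  have hP : x ∈ C P := by
    rw [hTS.2 _ hTwo' (Equiv.swap x w)]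
    refine ⟨w, ?_, Equiv.swap_apply_right x w⟩
    rw [← hTS.1 _ hTwo π] at hw
    exact hw
  have hPshift : P.topShift x w = P :=
    funext fun i => (R (π i)).topShift_map_swap x w
  rw [← hPshift] at hP
  have hxw (i : N) : (P i).rel x w ↔ (R (π i)).rel w x := by
    simp [P, Profile.map, WeakOrd.map, Profile.topShift, WeakOrd.topShift_rel_right_left]
  have hwx (i : N) : (P i).rel w x ↔ (R (π i)).rel x w := by
    simp [P, Profile.map, WeakOrd.map, Profile.topShift, WeakOrd.topShift_rel_left_right]
  refine hTM.mem_topShift hA hyx.symm hP (fun i hi => hπ' i ?_) (fun i hi => ?_)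
  · exact ⟨(hxw i).1 hi.1, fun h => hi.2 ((hwx i).2 h)⟩
  · by_contra hcon
    exact (hπ i ⟨((R i).total x w).resolve_left hcon, hcon⟩).2 ((hxw i).1 hi.1)
end

section
/- Top neutrality cannot be dropped from the characterization: there exists an SDR that satisfies top consistency (TC), top anonymity (TA), top monotonicity (TM) and top rationality (TR) but is not Condorcet-consistent; a witness is C₃ defined, for a fixed alternative a ∈ A, by C₃(R) = CW(R|_{A∖{a}}) if this set is nonempty and C₃(R) = A∖{a} otherwise, where R|_{A∖{a}} is the profile of restrictions of the voters' weak orders to A∖{a}. -/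
/-- The Condorcet winners of the restriction of `R` to a subset `X` of alternatives:
pairwise majority comparisons are unchanged inside `X`. -/
def CWon {N A : Type*} (R : Profile N A) (X : Set A) : Set A :=
  {x ∈ X | ∀ y ∈ X, y ≠ x → nwins R y x ≤ nwins R x y}

open Classical in
/-- The rule `C₃`: the Condorcet winners of the restriction of `R` to `A ∖ {a}`
if any, and `A ∖ {a}` otherwise. -/
noncomputable def C3 {N A : Type*} (a : A) (R : Profile N A) : Set A :=
  if (CWon R {b | b ≠ a}).Nonempty then CWon R {b | b ≠ a} else {b | b ≠ a}

theorem nwins_topShift_of_mem {N A : Type*} (R : Profile N A) {x y u v : A}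
    (hu : u = x ∨ u = y) (hv : v = x ∨ v = y) :
    nwins (R.topShift x y) u v = nwins R u v := by
  simp [nwins, Profile.topShift, WeakOrd.topShift, WeakOrd.strict, hu, hv]

theorem nwins_topShift_of_mem_of_notMem {N A : Type*} (R : Profile N A)
    {x y u v : A} (hu : u = x ∨ u = y) (hv : ¬ (v = x ∨ v = y)) :
    nwins (R.topShift x y) u v = Nat.card N := by
  simp only [nwins, Profile.topShift, WeakOrd.topShift, WeakOrd.strict, hu, hv, if_true, if_false,
    not_false_eq_true, and_self]
  exact Nat.card_congr (Equiv.subtypeUnivEquiv fun _ => trivial)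

theorem nwins_topShift_of_notMem_of_mem {N A : Type*} (R : Profile N A)
    {x y u v : A} (hu : u = x ∨ u = y) (hv : ¬ (v = x ∨ v = y)) :
    nwins (R.topShift x y) v u = 0 := by
  simp [nwins, Profile.topShift, WeakOrd.topShift, WeakOrd.strict, hu, hv]

theorem mem_CWon_topShift {N A : Type*} [Finite N] [Nonempty N] (R : Profile N A) {a x y w : A}
    (hxy : x ≠ y) :
    w ∈ CWon (R.topShift x y) {b | b ≠ a} ↔ w ≠ a ∧ (w = x ∨ w = y) ∧
      ∀ v, (v = x ∨ v = y) → v ≠ a → nwins R v w ≤ nwins R w v := by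
  have hpos : 0 < Nat.card N := Nat.card_pos
  constructor
  · rintro ⟨hwa, hw⟩
    have hmem : w = x ∨ w = y := by
      by_contra hn
      have key : ∀ u, (u = x ∨ u = y) → u ≠ a → False := fun u hu hua => by
        have h := hw u hua (fun h => hn (h ▸ hu))
        rw [nwins_topShift_of_mem_of_notMem R hu hn,
          nwins_topShift_of_notMem_of_mem R hu hn] at h
        omega
      by_cases hx : x = a
      · exact key y (Or.inr rfl) (fun h => hxy (hx.trans h.symm))
      · exact key x (Or.inl rfl) hx
    refine ⟨hwa, hmem, fun v hv hva => ?_⟩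
    by_cases hvw : v = w
    · rw [hvw]
    · have h := hw v hva hvw
      rwa [nwins_topShift_of_mem R hv hmem, nwins_topShift_of_mem R hmem hv] at h
  · rintro ⟨hwa, hmem, hw⟩
    refine ⟨hwa, fun v hva _ => ?_⟩
    by_cases hv : v = x ∨ v = y
    · rw [nwins_topShift_of_mem R hv hmem, nwins_topShift_of_mem R hmem hv]
      exact hw v hv hva
    · rw [nwins_topShift_of_notMem_of_mem R hmem hv]
      exact Nat.zero_le _

theorem CWon_topShift_inter_nonempty {N A : Type*} [Finite N] [Nonempty N] (R : Profile N A)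
    (a : A) {x y : A} (hxy : x ≠ y) :
    (CWon (R.topShift x y) {b | b ≠ a} ∩ {x, y}).Nonempty := by
  suffices h : x ∈ CWon (R.topShift x y) {b | b ≠ a} ∨
      y ∈ CWon (R.topShift x y) {b | b ≠ a} by
    rcases h with h | h
    · exact ⟨x, h, by simp⟩
    · exact ⟨y, h, by simp⟩
  rw [mem_CWon_topShift R hxy, mem_CWon_topShift R hxy]
  have := le_total (nwins R x y) (nwins R y x)
  grind

theorem C3_topShift {N A : Type*} [Finite N] [Nonempty N] (R : Profile N A) (a : A) {x y : A}
    (hxy : x ≠ y) : C3 a (R.topShift x y) = CWon (R.topShift x y) {b | b ≠ a} :=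
  if_pos (CWon_topShift_inter_nonempty R a hxy).left

theorem mem_C3_topShift {N A : Type*} [Finite N] [Nonempty N] (R : Profile N A) {a x y : A}
    (hxy : x ≠ y) :
    x ∈ C3 a (R.topShift x y) ↔ x ≠ a ∧ (y ≠ a → nwins R y x ≤ nwins R x y) := by
  rw [C3_topShift R a hxy, mem_CWon_topShift R hxy]
  grind

theorem niceSet_C3 {N A : Type*} [Finite N] [Nonempty N] [Nontrivial A] (R : Profile N A) (a : A) :
    niceSet (C3 a) R = CWon R {b | b ≠ a} := by
  ext x
  constructor
  · intro h
    obtain ⟨y, hy⟩ := exists_ne x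
    refine ⟨((mem_C3_topShift R hy.symm).1 (h y hy)).1, fun v hva hvx => ?_⟩
    exact ((mem_C3_topShift R hvx.symm).1 (h v hvx)).2 hva
  · rintro ⟨hxa, hx⟩ y hy
    exact (mem_C3_topShift R hy.symm).2 ⟨hxa, fun hya => hx y hya hy⟩

theorem nwins_comp_perm {N A : Type*} (R : Profile N A) (π : Equiv.Perm N) (x y : A) :
    nwins (fun i => R (π i)) x y = nwins R x y :=
  Nat.card_congr (π.subtypeEquiv fun _ => Iff.rfl)

theorem C3_comp_perm {N A : Type*} (a : A) (R : Profile N A) (π : Equiv.Perm N) :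
    C3 a (fun i => R (π i)) = C3 a R := by
  have h : CWon (fun i => R (π i)) {b | b ≠ a} = CWon R {b | b ≠ a} := by
    simp only [CWon, nwins_comp_perm]
  unfold C3
  rw [h]

theorem C3_nonempty {N A : Type*} [Nontrivial A] (a : A) (R : Profile N A) :
    (C3 a R).Nonempty := by
  unfold C3
  split_ifs with h
  · exact h
  · exact exists_ne a

theorem notMem_C3 {N A : Type*} (a : A) (R : Profile N A) : a ∉ C3 a R := by
  unfold C3
  split_ifs with h
  · exact fun h => h.1 rfl
  · exact fun h => h rfl

namespace Improves

variable {N A : Type*} {R Q : Profile N A} {x z : A}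

theorem strict_of_strict (h : Improves R Q x z) {i : N} {w : A} (hQ : (Q i).strict w x) :
    (R i).strict w x := by
  have hR : ¬ (R i).rel x w := fun hxw => by
    by_cases hwx : (R i).rel w x
    · exact hQ.2 ((h.1 i w).2 ⟨hxw, hwx⟩)
    · exact hQ.2 ((h.1 i w).1 ⟨hxw, hwx⟩).1
  exact ⟨((R i).total w x).resolve_right hR, hR⟩

variable [Finite N]

theorem nwins_le (h : Improves R Q x z) (w : A) : nwins R x w ≤ nwins Q x w :=
  Nat.card_mono (Set.toFinite _) fun i hi => (h.1 i w).1 hi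

theorem nwins_le' (h : Improves R Q x z) (w : A) : nwins Q w x ≤ nwins R w x :=
  Nat.card_mono (Set.toFinite _) fun _ hi => h.strict_of_strict hi

theorem nwins_lt_or_nwins_lt (h : Improves R Q x z) :
    nwins R x z < nwins Q x z ∨ nwins Q z x < nwins R z x := by
  obtain ⟨i, hR, hQ⟩ := h.2
  by_cases hi : (R i).rel x z
  · left
    exact Set.ncard_lt_ncard (s := {i | (R i).strict x z}) (t := {i | (Q i).strict x z})
      ⟨fun j hj => (h.1 j z).1 hj, fun hs => (hs hQ).2 hR⟩
  · right
    exact Set.ncard_lt_ncard (s := {i | (Q i).strict z x}) (t := {i | (R i).strict z x})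
      ⟨fun j hj => h.strict_of_strict hj,
        fun hs => hQ.2 (hs (show (R i).strict z x from ⟨hR, hi⟩)).1⟩

end Improves

theorem topMonotonicity_C3 {N A : Type*} [Finite N] [Nonempty N] (a : A) :
    TopMonotonicity (C3 (N := N) a) := by
  intro R Q x y z hxy hzx hx h
  rw [mem_C3_topShift R hxy] at hx
  refine ⟨(mem_C3_topShift Q hxy).2 ⟨hx.1, fun hy =>
    (h.nwins_le' y).trans ((hx.2 hy).trans (h.nwins_le y))⟩, fun hz => ?_⟩
  rw [C3_topShift Q a hxy, mem_CWon_topShift Q hxy] at hz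
  obtain ⟨hza, hzmem, hz⟩ := hz
  obtain rfl := hzmem.resolve_left hzx
  have h1 := hz x (Or.inl rfl) hx.1
  have h2 := hx.2 hza
  have h3 := h.nwins_le z
  have h4 := h.nwins_le' z
  have h5 := h.nwins_lt_or_nwins_lt
  omega

theorem not_condorcetConsistent_C3 {N A : Type*} (a : A) :
    ¬ CondorcetConsistent (C3 (N := N) a) := by
  intro h
  let R : Profile N A := fun _ =>
    ⟨fun _ _ => True, fun _ _ => Or.inl trivial, fun _ _ _ _ _ => trivial⟩
  have ha : a ∈ CW R := fun y _ => le_of_eq (by simp [nwins, R, WeakOrd.strict])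
  exact notMem_C3 a R (h R ⟨a, ha⟩ ▸ ha)

/-- TN cannot be dropped: for any fixed alternative `a`, the rule
`C₃` is an SDR satisfying TC, TA, TM and TR but it is not Condorcet-consistent. -/
theorem stmt_10 {N A : Type*} [Fintype N] [Fintype A]
    (hN : 2 ≤ Fintype.card N) (hA : 3 ≤ Fintype.card A) (a : A) :
    (∀ R : Profile N A, (C3 a R).Nonempty) ∧
    TopConsistency (C3 (N := N) a) ∧
    TopAnonymity (C3 (N := N) a) ∧
    TopMonotonicity (C3 (N := N) a) ∧
    TopRationality (C3 (N := N) a) ∧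
    ¬ CondorcetConsistent (C3 (N := N) a) := by
  have : Nonempty N := Fintype.card_pos_iff.1 (by omega)
  have : Nontrivial A := Fintype.one_lt_card_iff_nontrivial.1 (by omega)
  refine ⟨C3_nonempty a, fun R hR => ?_, fun R _ π => C3_comp_perm a R π,
    topMonotonicity_C3 a, fun R x y hxy => ?_, not_condorcetConsistent_C3 a⟩
  · rw [niceSet_C3] at hR ⊢
    exact if_pos hR
  · rw [C3_topShift R a hxy]
    exact CWon_topShift_inter_nonempty R a hxy
end

section
/- For n ≥ 3 with n ≠ 4 and m ≥ 3, every Condorcet-consistent SDR on the unrestricted domain fails to satisfy Maskin monotonicity: there exist profiles R,Q and an alternative x ∈ C(R) such that for every voter i and alternative y, x strictly preferred to y in R_i implies x strictly preferred to y in Q_i and x indifferent to y in R_i implies x weakly preferred to y in Q_i, yet x ∉ C(Q). -/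
open Classical in
/-- A strict absolute majority for `w` over `y` decides their pairwise comparison. -/
lemma nwins_lt_nwins_of_majority {N A : Type*} [Fintype N] (R : Profile N A) (w y : A)
    (P : N → Prop) (hP : 2 * Nat.card {i // P i} < Fintype.card N)
    (h : ∀ i, ¬ P i → (R i).strict w y) : nwins R y w < nwins R w y := by
  have h₁ : nwins R y w ≤ Nat.card {i // P i} :=
    Nat.card_le_card_of_injective
      (Subtype.map id fun i hi => by_contra fun hn => hi.2 (h i hn).1)
      (Subtype.map_injective _ Function.injective_id)
  have h₂ : Nat.card {i // ¬ P i} ≤ nwins R w y :=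
    Nat.card_le_card_of_injective (Subtype.map id h)
      (Subtype.map_injective _ Function.injective_id)
  have h₃ : Nat.card {i // ¬ P i} = Fintype.card N - Nat.card {i // P i} := by
    simp only [Nat.card_eq_fintype_card, Fintype.card_subtype_compl]
  omega

/-- The weak order obtained from `r` by moving `w` strictly above all other alternatives. -/
def WeakOrd.raise {A : Type*} (r : WeakOrd A) (w : A) : WeakOrd A where
  rel a b := a = w ∨ (b ≠ w ∧ r.rel a b)
  total a b := by
    have := r.total a b
    tauto
  trans a b c hab hbc := by
    have := r.trans a b c
    tauto

lemma WeakOrd.raise_strict {A : Type*} (r : WeakOrd A) {w y : A} (hy : y ≠ w) :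
    (r.raise w).strict w y :=
  ⟨Or.inl rfl, by rintro (h | h); exacts [hy h, h.1 rfl]⟩

open Classical in
/-- If every alternative is beaten by another one with a strict absolute majority in some
profile, then no Condorcet-consistent social decision rule is Maskin monotonic. -/
lemma CondorcetConsistent.not_maskinMonotonic_of_cycle {N A : Type*} [Fintype N]
    {C : Profile N A → Set A} (hCne : ∀ R, (C R).Nonempty) (hCC : CondorcetConsistent C)
    (R : Profile N A)
    (hR : ∀ x, ∃ w, 2 * Nat.card {i // ¬ (R i).strict w x} < Fintype.card N) :
    ∃ (R Q : Profile N A) (x : A), x ∈ C R ∧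
      (∀ (i : N) (y : A), ((R i).strict x y → (Q i).strict x y) ∧
        ((R i).indiff x y → (Q i).rel x y)) ∧
      x ∉ C Q := by
  obtain ⟨x, hx⟩ := hCne R
  obtain ⟨w, hw⟩ := hR x
  have hxw : x ≠ w := by
    rintro rfl
    have : Nat.card {i // ¬ (R i).strict x x} = Fintype.card N := by
      rw [← Nat.card_eq_fintype_card]
      exact Nat.card_congr (Equiv.subtypeUnivEquiv fun i h => h.2 h.1)
    omega
  let Q : Profile N A := fun i => if (R i).strict w x then (R i).raise w else R i
  have hQ : ∀ y, y ≠ w → nwins Q y w < nwins Q w y := fun y hy =>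
    nwins_lt_nwins_of_majority Q w y _ hw fun i hi => by
      simp only [Q, if_pos (not_not.1 hi)]
      exact (R i).raise_strict hy
  have hCW : w ∈ CW Q := fun y hy => (hQ y hy).le
  refine ⟨R, Q, x, hx, fun i y => ?_, fun hxQ => ?_⟩
  · by_cases hi : (R i).strict w x
    · simp only [Q, if_pos hi]
      have hyw : (R i).rel x y → y ≠ w := by
        rintro h rfl
        exact hi.2 h
      refine ⟨fun h => ⟨Or.inr ⟨hyw h.1, h.1⟩, ?_⟩, fun h => Or.inr ⟨hyw h.1, h.1⟩⟩
      rintro (h' | h')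
      exacts [hyw h.1 h', h.2 h'.2]
    · simp only [Q, if_neg hi]
      exact ⟨id, fun h => h.1⟩
  · rw [hCC Q ⟨w, hCW⟩] at hxQ
    exact absurd (hxQ w hxw.symm) (hQ x hxw).not_ge

/-- Except for four voters, at least three voters can be divided into three groups none of which
contains half of them. -/
lemma exists_three_minorities {N : Type*} [Fintype N] (hN3 : 3 ≤ Fintype.card N)
    (hN4 : Fintype.card N ≠ 4) :
    ∃ t : N → ZMod 3, ∀ j, 2 * Nat.card {i // t i = j} < Fintype.card N := by
  let e := Fintype.equivFin N
  refine ⟨fun i => ((e i : ℕ) : ZMod 3), fun j => ?_⟩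
  have h : Nat.card {i // ((e i : ℕ) : ZMod 3) = j} =
      (Fintype.card N).count (· ≡ j.val [MOD 3]) := by
    rw [Nat.count_eq_card_filter_range, ← Nat.card_eq_finsetCard]
    refine Nat.card_congr
      { toFun := fun i => ⟨e i.1, Finset.mem_filter.2 ⟨Finset.mem_range.2 (e i.1).2, ?_⟩⟩
        invFun := fun k =>
          ⟨e.symm ⟨k.1, Finset.mem_range.1 (Finset.mem_filter.1 k.2).1⟩, ?_⟩
        left_inv := fun i => by simp
        right_inv := fun k => by simp }
    · rw [← ZMod.natCast_eq_natCast_iff, ZMod.natCast_zmod_val]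
      exact i.2
    · have := (Finset.mem_filter.1 k.2).2
      rw [← ZMod.natCast_eq_natCast_iff, ZMod.natCast_zmod_val] at this
      simpa using this
  rw [h, Nat.count_modEq_card _ (by norm_num)]
  split_ifs <;> omega

/-- The weak order with three indifference classes, the fibres of `s`, ranked cyclically
starting from class `j`. -/
def WeakOrd.cyclic {A : Type*} (s : A → ZMod 3) (j : ZMod 3) : WeakOrd A where
  rel x y := (s x - j).val ≤ (s y - j).val
  total _ _ := le_total _ _
  trans _ _ _ := le_trans

lemma WeakOrd.cyclic_strict {A : Type*} {s : A → ZMod 3} {j : ZMod 3} {w x : A}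
    (hw : s w = s x - 1) (hj : j ≠ s x) : (WeakOrd.cyclic s j).strict w x := by
  have key : ∀ k j : ZMod 3, j ≠ k → (k - 1 - j).val < (k - j).val := by decide
  have := key (s x) j hj
  rw [← hw] at this
  exact ⟨this.le, this.not_ge⟩

/-- For `n ≥ 3`, `n ≠ 4` and `m ≥ 3`, every Condorcet-consistent
SDR on the unrestricted domain fails Maskin monotonicity. -/
theorem stmt_14 {N A : Type*} [Fintype N] [Fintype A]
    (hN3 : 3 ≤ Fintype.card N) (hN4 : Fintype.card N ≠ 4)
    (hA : 3 ≤ Fintype.card A)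
    (C : Profile N A → Set A) (hCne : ∀ R, (C R).Nonempty)
    (hCC : CondorcetConsistent C) :
    ∃ (R Q : Profile N A) (x : A), x ∈ C R ∧
      (∀ (i : N) (y : A), ((R i).strict x y → (Q i).strict x y) ∧
        ((R i).indiff x y → (Q i).rel x y)) ∧
      x ∉ C Q := by
  obtain ⟨t, ht⟩ := exists_three_minorities hN3 hN4
  obtain ⟨f⟩ : Nonempty (ZMod 3 ↪ A) :=
    Function.Embedding.nonempty_of_card_le (by simpa [ZMod.card] using hA)
  let s : A → ZMod 3 := Function.invFun f
  have hs : ∀ k, s (f k) = k := Function.leftInverse_invFun f.injective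
  refine hCC.not_maskinMonotonic_of_cycle hCne (fun i => WeakOrd.cyclic s (t i)) fun x =>
    ⟨f (s x - 1), lt_of_le_of_lt ?_ (ht (s x))⟩
  refine Nat.mul_le_mul_left 2 (Nat.card_le_card_of_injective
    (Subtype.map id fun i hi => ?_) (Subtype.map_injective _ Function.injective_id))
  exact by_contra fun hj => hi (WeakOrd.cyclic_strict (hs _) hj)
end

section
/- If an SDR C satisfies weak top consistency (WTC) and Maskin monotonicity (MM), then C satisfies top consistency (TC): for every profile R with N_C(R) ≠ ∅, C(R) = N_C(R). -/
/-- If an SDR satisfies WTC and Maskin monotonicity, then it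
satisfies TC. -/
theorem stmt_15 {N A : Type*} [Fintype N] [Fintype A]
    (hN : 2 ≤ Fintype.card N) (hA : 3 ≤ Fintype.card A)
    (C : Profile N A → Set A) (hCne : ∀ R, (C R).Nonempty)
    (hWTC : WeakTopConsistency C) (hMM : MaskinMonotonic C) :
    TopConsistency C := by
  refine fun R _ => (hWTC R).antisymm' fun x hx y _ => hMM R _ x hx fun i w => ?_
  simp only [WeakOrd.strict, WeakOrd.indiff, Profile.topShift, WeakOrd.topShift]
  by_cases hw : w = x ∨ w = y <;> simp +contextual [hw]
end
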